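/- Let the coefficients satisfy Hypotheses (H) and let G(t,s) be the associated evolution operator. Let {μ_t : t ≥ 0} be a tight evolution system of measures for G(t,s). Then for every s ≥ 0 and every f ∈ C_b(ℝ^d), the functions G(t,s)f converge to the constant m_s(f) uniformly on every compact subset of ℝ^d as t → +∞. -/

import Mathlib

open MeasureTheory Filter Topology Metric Set
open scoped RealInnerProductSpace

noncomputable section

abbrev Ed (d : ℕ) := EuclideanSpace ℝ (Fin d)

/-- `f` belongs to `C_b(ℝ^d)`: it is bounded and continuous. -/
def IsCb {d : ℕ} (f : Ed d → ℝ) : Prop :=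
  Continuous f ∧ ∃ M, ∀ x, |f x| ≤ M

/-- The action of the operator `A(t)φ = Tr(Q(t,·)D²φ) + ⟨b(t,·),∇φ⟩`. -/
def applyA {d : ℕ} (q : ℝ → Ed d → Matrix (Fin d) (Fin d) ℝ) (b : ℝ → Ed d → Ed d)
    (t : ℝ) (u : Ed d → ℝ) (x : Ed d) : ℝ :=
  (∑ i, ∑ j, q t x i j *
      iteratedFDeriv ℝ 2 u x ![EuclideanSpace.single i 1, EuclideanSpace.single j 1]) +
    ⟪b t x, gradient u x⟫

/-- `u` is a bounded classical solution (in `C_b([s,∞)×ℝ^d) ∩ C^{1,2}((s,∞)×ℝ^d)`)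
of `D_t u = A(t)u` on `(s,∞)×ℝ^d` with `u(s,·) = f`. -/
structure IsBoundedClassicalSolution {d : ℕ} (q : ℝ → Ed d → Matrix (Fin d) (Fin d) ℝ)
    (b : ℝ → Ed d → Ed d) (s : ℝ) (f : Ed d → ℝ) (u : ℝ → Ed d → ℝ) : Prop where
  cont : ContinuousOn (fun z : ℝ × Ed d => u z.1 z.2) (Ici s ×ˢ (univ : Set (Ed d)))
  bdd : ∃ M, ∀ t ∈ Ici s, ∀ x, |u t x| ≤ M
  smooth_space : ∀ t ∈ Ioi s, ContDiff ℝ 2 (u t)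
  pde : ∀ t ∈ Ioi s, ∀ x, HasDerivAt (fun τ => u τ x) (applyA q b t (u t) x) t
  init : ∀ x, u s x = f x

/-- Hypotheses (H), together with the associated evolution operator `G(t,s)`. -/
structure Hypotheses (d : ℕ) where
  /-- the Hölder exponent -/
  α : ℝ
  hα : α ∈ Ioo (0:ℝ) 1
  /-- the diffusion coefficients -/
  q : ℝ → Ed d → Matrix (Fin d) (Fin d) ℝ
  /-- the drift coefficients -/
  b : ℝ → Ed d → Ed d
  /-- the ellipticity function -/
  η : ℝ → Ed d → ℝ
  η₀ : ℝ
  -- (i): local regularity `C^{α/2,1+α}_loc`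
  q_diff : ∀ t ∈ Ici (0:ℝ), ∀ i j, Differentiable ℝ fun x => q t x i j
  b_diff : ∀ t ∈ Ici (0:ℝ), Differentiable ℝ (b t)
  q_locHolder : ∀ i j, ∀ T > (0:ℝ), ∀ R > (0:ℝ), ∃ L : ℝ,
    ∀ t ∈ Icc (0:ℝ) T, ∀ s ∈ Icc (0:ℝ) T,
      ∀ x ∈ closedBall (0 : Ed d) R, ∀ y ∈ closedBall (0 : Ed d) R,
        |q t x i j - q s y i j| ≤ L * (|t - s| ^ (α/2) + ‖x - y‖ ^ α) ∧
        ‖gradient (fun z => q t z i j) x - gradient (fun z => q s z i j) y‖ ≤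
          L * (|t - s| ^ (α/2) + ‖x - y‖ ^ α)
  b_locHolder : ∀ i, ∀ T > (0:ℝ), ∀ R > (0:ℝ), ∃ L : ℝ,
    ∀ t ∈ Icc (0:ℝ) T, ∀ s ∈ Icc (0:ℝ) T,
      ∀ x ∈ closedBall (0 : Ed d) R, ∀ y ∈ closedBall (0 : Ed d) R,
        |b t x i - b s y i| ≤ L * (|t - s| ^ (α/2) + ‖x - y‖ ^ α) ∧
        ‖gradient (fun z => b t z i) x - gradient (fun z => b s z i) y‖ ≤
          L * (|t - s| ^ (α/2) + ‖x - y‖ ^ α)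
  -- (i): boundedness on `[0,∞) × B_R` and uniform-in-time `L^p(B_R)` bounds
  q_bdd : ∀ R > (0:ℝ), ∃ M : ℝ, ∀ t ∈ Ici (0:ℝ), ∀ x ∈ ball (0 : Ed d) R, ∀ i j,
    |q t x i j| ≤ M
  q_cont : ∀ R > (0:ℝ), ∀ i j, ContinuousOn (fun z : ℝ × Ed d => q z.1 z.2 i j)
    (Ici (0:ℝ) ×ˢ ball (0 : Ed d) R)
  int_bdd : ∃ p : ℝ, (d : ℝ) + 2 < p ∧ ∀ R > (0:ℝ), ∃ M : ℝ, ∀ t ∈ Ici (0:ℝ), ∀ i j : Fin d,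
    (∫ x in ball (0 : Ed d) R, ‖gradient (fun z => q t z i j) x‖ ^ p) ≤ M ∧
    (∫ x in ball (0 : Ed d) R, |b t x j| ^ p) ≤ M
  -- (ii): symmetry and ellipticity
  q_symm : ∀ t ∈ Ici (0:ℝ), ∀ x, (q t x).IsSymm
  hη₀ : 0 < η₀
  η_lb : ∀ t ∈ Ici (0:ℝ), ∀ x, η₀ ≤ η t x
  ellipticity : ∀ t ∈ Ici (0:ℝ), ∀ x, ∀ ξ : Ed d,
    η t x * ‖ξ‖ ^ 2 ≤ ∑ i, ∑ j, q t x i j * ξ i * ξ j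
  -- (iii): Lyapunov function
  V : Ed d → ℝ
  V_pos : ∀ x, 0 < V x
  V_C2 : ContDiff ℝ 2 V
  V_tendsto : Tendsto V (comap (fun x : Ed d => ‖x‖) atTop) atTop
  a : ℝ
  κ : ℝ
  ha : 0 ≤ a
  hκ : 0 < κ
  lyapunov : ∀ t ∈ Ici (0:ℝ), ∀ x, applyA q b t V x ≤ a - κ * V x
  -- (iv): bounds on the space derivatives of the coefficients
  c₀ : ℝ
  r₀ : ℝ
  hc₀ : 0 ≤ c₀
  gradQ_bdd : ∀ t ∈ Ici (0:ℝ), ∀ x,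
    Real.sqrt (∑ i, ∑ j, ‖gradient (fun z => q t z i j) x‖ ^ 2) ≤ c₀ * η t x
  b_dissip : ∀ t ∈ Ici (0:ℝ), ∀ x, ∀ ξ : Ed d, ⟪fderiv ℝ (b t) x ξ, ξ⟫ ≤ r₀ * ‖ξ‖ ^ 2
  -- (v): growth conditions
  growth : ∃ c > (0:ℝ),
    (∀ t ∈ Ici (0:ℝ), ∀ x,
        Real.sqrt (∑ i, ∑ j, (q t x i j) ^ 2) ≤ c * (1 + ‖x‖) * V x ∧
        ⟪b t x, x⟫ ≤ c * (1 + ‖x‖ ^ 2) * V x) ∨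
    (∀ t ∈ Ici (0:ℝ), ∀ x, Real.sqrt (∑ i, ∑ j, (q t x i j) ^ 2) ≤ c)
  /-- the evolution operator -/
  G : ℝ → ℝ → (Ed d → ℝ) → Ed d → ℝ
  G_sol : ∀ s ∈ Ici (0:ℝ), ∀ f, IsCb f →
    IsBoundedClassicalSolution q b s f fun t => G t s f
  G_unique : ∀ s ∈ Ici (0:ℝ), ∀ f, IsCb f → ∀ u,
    IsBoundedClassicalSolution q b s f u → ∀ t ∈ Ici s, ∀ x, u t x = G t s f x

/-- `{μ_t : t ≥ 0}` is an evolution system of measures for `G(t,s)`. -/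
def IsEvolutionSystem {d : ℕ} (H : Hypotheses d) (μ : ℝ → Measure (Ed d)) : Prop :=
  (∀ t ∈ Ici (0:ℝ), IsProbabilityMeasure (μ t)) ∧
    ∀ f, IsCb f → ∀ s ∈ Ici (0:ℝ), ∀ t ∈ Ici s,
      ∫ x, H.G t s f x ∂μ t = ∫ x, f x ∂μ s

/-- The system `{μ_t : t ≥ 0}` is tight. -/
def IsTightSystem {d : ℕ} (μ : ℝ → Measure (Ed d)) : Prop :=
  ∀ ε > (0:ℝ), ∃ R > (0:ℝ), ∀ t ∈ Ici (0:ℝ),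
    ENNReal.ofReal (1 - ε) ≤ μ t (ball (0 : Ed d) R)


lemma oneD_second {g g' : ℝ → ℝ} {A k : ℝ} (hg : ∀ τ, HasDerivAt g (g' τ) τ)
    (hg' : HasDerivAt g' A 0)
    (h : ∀ᶠ τ in 𝓝[>] (0:ℝ), g τ + g (-τ) - 2 * g 0 ≤ k * τ ^ 2) : A ≤ k := by
  by_contra hlt
  push Not at hlt
  set h1 : ℝ → ℝ := fun τ => g' τ - g' (-τ) - 2 * k * τ with hh1
  have hd1 : HasDerivAt h1 (2 * A - 2 * k) 0 := by
    have h2 : HasDerivAt (fun τ : ℝ => g' (-τ)) (-A) 0 := by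
      have := HasDerivAt.comp (0:ℝ) (h₂ := g') (h := fun τ : ℝ => -τ) (h₂' := A) (h' := -1)
        (by simpa using hg') (hasDerivAt_neg 0)
      simpa [Function.comp_def] using this
    have h3 : HasDerivAt (fun τ : ℝ => 2 * k * τ) (2 * k) 0 := by
      simpa using (hasDerivAt_id (0:ℝ)).const_mul (2 * k)
    have h6 := (hg'.sub h2).sub h3
    rw [show 2 * A - 2 * k = A - -A - 2 * k by ring]
    exact h6
  have hpos : ∀ᶠ τ in 𝓝[>] (0:ℝ), 0 < h1 τ := by
    have h0 := hd1.tendsto_slope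
    have h4 : ∀ᶠ τ in 𝓝[≠] (0:ℝ), 0 < slope h1 0 τ :=
      h0.eventually (lt_mem_nhds (by linarith))
    have h5 : ∀ᶠ τ in 𝓝[>] (0:ℝ), 0 < slope h1 0 τ :=
      h4.filter_mono (nhdsWithin_mono _ (fun x hx => ne_of_gt hx))
    filter_upwards [h5, self_mem_nhdsWithin] with τ hτ hτ0
    have hz : h1 0 = 0 := by simp [hh1]
    rw [slope_def_field, hz] at hτ
    simp only [sub_zero] at hτ
    exact (div_pos_iff_of_pos_right hτ0).1 hτ
  set H : ℝ → ℝ := fun τ => g τ + g (-τ) - k * τ ^ 2 with hH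
  have hHd : ∀ τ, HasDerivAt H (h1 τ) τ := by
    intro τ
    have h2 : HasDerivAt (fun τ : ℝ => g (-τ)) (-g' (-τ)) τ := by
      have := HasDerivAt.comp τ (hg (-τ)) (hasDerivAt_neg τ)
      simpa [Function.comp_def] using this
    have h3 : HasDerivAt (fun τ : ℝ => k * τ ^ 2) (2 * k * τ) τ := by
      have h7 := (hasDerivAt_pow 2 τ).const_mul k
      rw [show 2 * k * τ = k * (((2:ℕ):ℝ) * τ ^ (2 - 1)) by norm_num; ring]
      exact h7
    have h8 := ((hg τ).add h2).sub h3
    rw [show h1 τ = g' τ + -g' (-τ) - 2 * k * τ by simp only [hh1]; ring]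
    exact h8
  obtain ⟨δ, hδ, hδ'⟩ := mem_nhdsGT_iff_exists_Ioc_subset.1 (hpos.and h)
  have hmono : StrictMonoOn H (Icc 0 δ) := by
    apply strictMonoOn_of_deriv_pos (convex_Icc 0 δ)
    · exact fun τ _ => (hHd τ).continuousAt.continuousWithinAt
    · intro τ hτ
      rw [interior_Icc] at hτ
      rw [(hHd τ).deriv]
      exact (hδ' ⟨hτ.1, hτ.2.le⟩).1
  have hδ0 : (0:ℝ) < δ := hδ
  have e1 := hmono (left_mem_Icc.2 hδ0.le) (right_mem_Icc.2 hδ0.le) hδ0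
  have e2 := (hδ' ⟨hδ0, le_refl δ⟩).2
  simp only [hH] at e1
  norm_num at e1
  linarith

lemma oneD_first {g : ℝ → ℝ} {A k K : ℝ} (hg : HasDerivAt g A 0)
    (h : ∀ᶠ τ in 𝓝[>] (0:ℝ), g τ - g 0 ≤ k * τ + K * τ ^ 2) : A ≤ k := by
  have h0 : Tendsto (slope g 0) (𝓝[>] 0) (𝓝 A) :=
    hg.tendsto_slope.mono_left (nhdsWithin_mono _ (fun x hx => ne_of_gt hx))
  have h1 : Tendsto (fun τ : ℝ => k + K * τ) (𝓝[>] 0) (𝓝 k) := by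
    have : Continuous (fun τ : ℝ => k + K * τ) := by fun_prop
    have := this.tendsto 0
    simp at this
    exact this.mono_left nhdsWithin_le_nhds
  refine le_of_tendsto_of_tendsto h0 h1 ?_
  filter_upwards [h, self_mem_nhdsWithin] with τ hτ hτ0
  have hτ0' : (0:ℝ) < τ := hτ0
  rw [slope_def_field, sub_zero, div_le_iff₀ hτ0']
  nlinarith

lemma line_deriv {d : ℕ} {F : Ed d → ℝ} (hF : ContDiff ℝ 2 F) (x v : Ed d) (τ : ℝ) :
    HasDerivAt (fun τ : ℝ => F (x + τ • v)) (fderiv ℝ F (x + τ • v) v) τ := by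
  have h1 : HasDerivAt (fun τ : ℝ => x + τ • v) v τ := by
    simpa using ((hasDerivAt_id τ).smul_const v).const_add x
  exact ((hF.differentiable (by norm_num)) _).hasFDerivAt.comp_hasDerivAt τ h1

lemma line_deriv2 {d : ℕ} {F : Ed d → ℝ} (hF : ContDiff ℝ 2 F) (x v : Ed d) :
    HasDerivAt (fun τ : ℝ => fderiv ℝ F (x + τ • v) v)
      (fderiv ℝ (fderiv ℝ F) x v v) 0 := by
  have h1 : HasDerivAt (fun τ : ℝ => x + τ • v) v 0 := by
    simpa using ((hasDerivAt_id (0:ℝ)).smul_const v).const_add x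
  have h2 : ContDiff ℝ 1 (fderiv ℝ F) := hF.fderiv_right (by norm_num)
  have h3 := ((h2.differentiable (by norm_num)) (x + (0:ℝ) • v)).hasFDerivAt.comp_hasDerivAt
    (0:ℝ) h1
  have h4 := h3.clm_apply (hasDerivAt_const (0:ℝ) v)
  simpa using h4

lemma pair_second {d : ℕ} {P N : Ed d → ℝ} (hP : ContDiff ℝ 2 P) (hN : ContDiff ℝ 2 N)
    (x y v w : Ed d) (k : ℝ)
    (h : ∀ᶠ τ in 𝓝[>] (0:ℝ), (P (x + τ • v) - N (y + τ • w)) +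
      (P (x + (-τ) • v) - N (y + (-τ) • w)) - 2 * (P x - N y) ≤ k * τ ^ 2) :
    fderiv ℝ (fderiv ℝ P) x v v - fderiv ℝ (fderiv ℝ N) y w w ≤ k := by
  refine oneD_second (g := fun τ => P (x + τ • v) - N (y + τ • w))
    (fun τ => (line_deriv hP x v τ).sub (line_deriv hN y w τ))
    ((line_deriv2 hP x v).sub (line_deriv2 hN y w)) ?_
  simpa using h

lemma pair_first {d : ℕ} {P N : Ed d → ℝ} (hP : ContDiff ℝ 2 P) (hN : ContDiff ℝ 2 N)
    (x y v w : Ed d) (k K : ℝ)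
    (h : ∀ᶠ τ in 𝓝[>] (0:ℝ), (P (x + τ • v) - N (y + τ • w)) - (P x - N y)
      ≤ k * τ + K * τ ^ 2) :
    fderiv ℝ P x v - fderiv ℝ N y w ≤ k := by
  have h1 := (line_deriv hP x v 0).sub (line_deriv hN y w 0)
  simp only [zero_smul, add_zero] at h1
  refine oneD_first (K := K) h1 ?_
  simpa using h

lemma applyA_eq {d : ℕ} (q : ℝ → Ed d → Matrix (Fin d) (Fin d) ℝ) (b : ℝ → Ed d → Ed d)
    (t : ℝ) (u : Ed d → ℝ) (x : Ed d) :
    applyA q b t u x = (∑ i, ∑ j, q t x i j *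
      fderiv ℝ (fderiv ℝ u) x (EuclideanSpace.single i 1) (EuclideanSpace.single j 1)) +
      fderiv ℝ u x (b t x) := by
  unfold applyA
  congr 1
  · simp [iteratedFDeriv_two_apply]
  · rw [real_inner_comm]
    simp [gradient]

lemma applyA_add {d : ℕ} (q : ℝ → Ed d → Matrix (Fin d) (Fin d) ℝ) (b : ℝ → Ed d → Ed d)
    (t : ℝ) {u v : Ed d → ℝ} (hu : ContDiff ℝ 2 u) (hv : ContDiff ℝ 2 v) (c : ℝ) (x : Ed d) :
    applyA q b t (fun z => u z + c * v z) x = applyA q b t u x + c * applyA q b t v x := by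
  have hu1 := hu.differentiable (by norm_num)
  have hv1 := hv.differentiable (by norm_num)
  have h1 : fderiv ℝ (fun z => u z + c * v z) = fun z => fderiv ℝ u z + c • fderiv ℝ v z := by
    funext z
    rw [fderiv_fun_add (hu1 z) ((hv1 z).const_mul c), fderiv_const_mul (hv1 z)]
  have hu2 := (hu.fderiv_right (m := 1) (by norm_num)).differentiable (by norm_num)
  have hv2 := (hv.fderiv_right (m := 1) (by norm_num)).differentiable (by norm_num)
  have h2 : fderiv ℝ (fderiv ℝ (fun z => u z + c * v z)) x =
      fderiv ℝ (fderiv ℝ u) x + c • fderiv ℝ (fderiv ℝ v) x := by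
    rw [h1]
    exact ((hu2 x).hasFDerivAt.add ((hv2 x).hasFDerivAt.const_smul c)).fderiv
  rw [applyA_eq, applyA_eq, applyA_eq, h2, h1]
  simp only [add_apply, smul_apply, smul_eq_mul,
    mul_add, Finset.sum_add_distrib, Finset.mul_sum]
  have : ∀ i j, q t x i j * (c * fderiv ℝ (fderiv ℝ v) x (EuclideanSpace.single i 1)
      (EuclideanSpace.single j 1)) = c * (q t x i j * fderiv ℝ (fderiv ℝ v) x
      (EuclideanSpace.single i 1) (EuclideanSpace.single j 1)) := by intros; ring
  simp only [this]
  ring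

/-- the `k`-th column of a matrix as a Euclidean vector -/
def colv {d : ℕ} (S : Matrix (Fin d) (Fin d) ℝ) (k : Fin d) : Ed d :=
  WithLp.toLp 2 (fun i => S i k)

lemma colv_eq {d : ℕ} (S : Matrix (Fin d) (Fin d) ℝ) (k : Fin d) :
    colv S k = ∑ i, S i k • (EuclideanSpace.single i (1:ℝ) : Ed d) := by
  ext j
  simp [colv, Finset.sum_apply, Pi.single_apply]

lemma sum_colv {d : ℕ} (B : Ed d →L[ℝ] Ed d →L[ℝ] ℝ) (S : Matrix (Fin d) (Fin d) ℝ) :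
    ∑ k, B (colv S k) (colv S k) = ∑ i, ∑ j, (S * S.transpose) i j *
      B (EuclideanSpace.single i 1) (EuclideanSpace.single j 1) := by
  simp only [colv_eq, map_sum, sum_apply, map_smul,
    smul_apply, smul_eq_mul, Matrix.mul_apply, Matrix.transpose_apply,
    Finset.sum_mul, Finset.mul_sum]
  rw [Finset.sum_comm]
  conv_rhs => rw [Finset.sum_comm]
  refine Finset.sum_congr rfl fun j _ => ?_
  rw [Finset.sum_comm]
  refine Finset.sum_congr rfl fun i _ => ?_
  refine Finset.sum_congr rfl fun k _ => ?_
  ring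

lemma exists_sqrt {d : ℕ} (A : Matrix (Fin d) (Fin d) ℝ) (hA : A.IsSymm) (m : ℝ) (hm : 0 ≤ m)
    (hpos : ∀ v : Fin d → ℝ, m * ∑ i, v i ^ 2 ≤ ∑ i, ∑ j, A i j * v i * v j) :
    ∃ S : Matrix (Fin d) (Fin d) ℝ, S.IsSymm ∧ S * S = A ∧
      ∀ v : Fin d → ℝ, Real.sqrt m * ∑ i, v i ^ 2 ≤ ∑ i, ∑ j, S i j * v i * v j := by
  have hH : A.IsHermitian := by
    rw [Matrix.IsHermitian, Matrix.conjTranspose_eq_transpose_of_trivial]; exact hA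
  set U : Matrix (Fin d) (Fin d) ℝ := (hH.eigenvectorUnitary : Matrix (Fin d) (Fin d) ℝ) with hU
  have hUU : U.transpose * U = 1 := by
    have := Unitary.coe_star_mul_self hH.eigenvectorUnitary
    rwa [Matrix.star_eq_conjTranspose, Matrix.conjTranspose_eq_transpose_of_trivial] at this
  have hUU' : U * U.transpose = 1 :=
     mul_eq_one_comm.1 hUU
  have hsp : A = U * Matrix.diagonal hH.eigenvalues * U.transpose := by
    have := hH.spectral_theorem
    rw [Unitary.conjStarAlgAut_apply, Matrix.star_eq_conjTranspose,
      Matrix.conjTranspose_eq_transpose_of_trivial] at this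
    exact this
  -- quadratic forms of `U D Uᵀ`
  have quad : ∀ (D : Fin d → ℝ) (v : Fin d → ℝ),
      ∑ i, ∑ j, (U * Matrix.diagonal D * U.transpose) i j * v i * v j =
        ∑ k, D k * (∑ i, U i k * v i) ^ 2 := by
    intro D v
    have hent : ∀ i j, (U * Matrix.diagonal D * U.transpose) i j =
        ∑ k, U i k * D k * U j k := by
      intro i j
      rw [Matrix.mul_apply]
      simp only [Matrix.mul_diagonal, Matrix.transpose_apply]
    simp only [hent, Finset.sum_mul, sq, Finset.mul_sum]
    rw [Finset.sum_comm]
    conv_lhs => enter [2, j]; rw [Finset.sum_comm]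
    rw [Finset.sum_comm]
    refine Finset.sum_congr rfl fun k _ => Finset.sum_congr rfl fun j _ =>
      Finset.sum_congr rfl fun i _ => ?_
    ring
  have hone : ∀ v : Fin d → ℝ, ∑ i, v i ^ 2 = ∑ k, (∑ i, U i k * v i) ^ 2 := by
    intro v
    have := quad (fun _ => 1) v
    rw [Matrix.diagonal_one, Matrix.mul_one, hUU'] at this
    simp only [one_mul] at this
    rw [← this]
    simp [Matrix.one_apply, sq]
  have hev : ∀ k, m ≤ hH.eigenvalues k := by
    intro k
    have h1 := hpos (fun i => U i k)
    have hk : ∀ l, ∑ i, U i l * U i k = if l = k then 1 else 0 := by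
      intro l
      have := congrFun (congrFun hUU l) k
      simpa [Matrix.mul_apply, Matrix.one_apply] using this
    rw [hone] at h1
    have h2 : ∑ i, ∑ j, A i j * U i k * U j k = hH.eigenvalues k := by
      conv_lhs => rw [hsp]
      rw [quad]
      simp [hk]
    rw [h2] at h1
    simpa [hk] using h1
  refine ⟨U * Matrix.diagonal (fun k => Real.sqrt (hH.eigenvalues k)) * U.transpose, ?_, ?_, ?_⟩
  · rw [Matrix.IsSymm]
    simp [Matrix.transpose_mul, Matrix.mul_assoc]
  · have : ∀ D : Matrix (Fin d) (Fin d) ℝ, U * D * U.transpose * (U * D * U.transpose) =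
        U * (D * D) * U.transpose := by
      intro D
      calc _ = U * D * (U.transpose * U) * D * U.transpose := by simp only [Matrix.mul_assoc]
        _ = _ := by rw [hUU]; simp only [Matrix.mul_assoc, Matrix.mul_one]
    rw [this, Matrix.diagonal_mul_diagonal]
    conv_rhs => rw [hsp]
    congr 3
    funext k
    exact Real.mul_self_sqrt (hm.trans (hev k))
  · intro v
    rw [quad, hone, Finset.mul_sum]
    exact Finset.sum_le_sum fun k _ =>
      mul_le_mul_of_nonneg_right (Real.sqrt_le_sqrt (hev k)) (sq_nonneg _)

lemma sqrt_lip {d : ℕ} (S T : Matrix (Fin d) (Fin d) ℝ) (hS : S.IsSymm) (hT : T.IsSymm) (m : ℝ)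
    (hm : 0 < m)
    (hS' : ∀ v : Fin d → ℝ, Real.sqrt m * ∑ i, v i ^ 2 ≤ ∑ i, ∑ j, S i j * v i * v j)
    (hT' : ∀ v : Fin d → ℝ, Real.sqrt m * ∑ i, v i ^ 2 ≤ ∑ i, ∑ j, T i j * v i * v j)
    (δ : ℝ) (hδ : ∀ i j, |(S * S) i j - (T * T) i j| ≤ δ) :
    ∑ k, ∑ i, (S i k - T i k) ^ 2 ≤ (d:ℝ) ^ 2 * δ ^ 2 / (4 * m) := by
  set D := S - T with hD
  have hDs : ∀ i j, D i j = D j i := by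
    intro i j
    have := (hS.sub hT)
    exact (this.apply i j).symm
  have hD' : ∀ i k, S i k - T i k = D i k := fun i k => rfl
  simp only [hD']
  set F := ∑ k, ∑ i, D i k ^ 2 with hF
  set μ := Real.sqrt m with hμ
  have hμ0 : 0 < μ := Real.sqrt_pos.2 hm
  have hμ2 : μ * μ = m := Real.mul_self_sqrt hm.le
  have hid : S * S - T * T = S * D + D * T := by
    rw [hD, Matrix.mul_sub, Matrix.sub_mul]; abel
  have h1 : μ * F ≤ ∑ i, ∑ k, (S * D) i k * D i k := by
    have : ∑ i, ∑ k, (S * D) i k * D i k = ∑ k, ∑ i, ∑ j, S i j * D i k * D j k := by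
      rw [Finset.sum_comm]
      simp only [Matrix.mul_apply, Finset.sum_mul]
      exact Finset.sum_congr rfl fun k _ => Finset.sum_congr rfl fun i _ =>
        Finset.sum_congr rfl fun j _ => by ring
    rw [this, hF, Finset.mul_sum]
    exact Finset.sum_le_sum fun k _ => hS' (fun i => D i k)
  have h2 : μ * F ≤ ∑ i, ∑ k, (D * T) i k * D i k := by
    have : ∑ i, ∑ k, (D * T) i k * D i k = ∑ k, ∑ i, ∑ j, T i j * D i k * D j k := by
      simp only [Matrix.mul_apply, Finset.sum_mul]
      refine Finset.sum_congr rfl fun k _ => ?_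
      rw [Finset.sum_comm]
      refine Finset.sum_congr rfl fun i _ => Finset.sum_congr rfl fun j _ => ?_
      rw [hDs i k, hDs j k]; ring
    rw [this, hF, Finset.mul_sum]
    exact Finset.sum_le_sum fun k _ => hT' (fun i => D i k)
  have h3 : ∑ i, ∑ k, ((S * S) i k - (T * T) i k) * D i k ≤
      ∑ i, ∑ k, (δ ^ 2 / (4 * μ) + μ * D i k ^ 2) := by
    refine Finset.sum_le_sum fun i _ => Finset.sum_le_sum fun k _ => ?_
    have ha : ((S * S) i k - (T * T) i k) ^ 2 ≤ δ ^ 2 := by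
      rw [← sq_abs]
      exact pow_le_pow_left₀ (abs_nonneg _) (hδ i k) 2
    have hb : ((S * S) i k - (T * T) i k) * D i k ≤
        ((S * S) i k - (T * T) i k) ^ 2 / (4 * μ) + μ * D i k ^ 2 := by
      rw [div_add' _ _ _ (by positivity), le_div_iff₀ (by positivity)]
      nlinarith [sq_nonneg (((S * S) i k - (T * T) i k) - 2 * μ * D i k)]
    have hc : ((S * S) i k - (T * T) i k) ^ 2 / (4 * μ) ≤ δ ^ 2 / (4 * μ) := by gcongr
    linarith
  have h4 : ∑ i, ∑ k, ((S * S) i k - (T * T) i k) * D i k =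
      ∑ i, ∑ k, (S * D) i k * D i k + ∑ i, ∑ k, (D * T) i k * D i k := by
    simp only [← Finset.sum_add_distrib]
    refine Finset.sum_congr rfl fun i _ => Finset.sum_congr rfl fun k _ => ?_
    have := congrFun (congrFun hid i) k
    simp only [Matrix.sub_apply, Matrix.add_apply] at this
    rw [this]; ring
  have h5 : ∑ i, ∑ k, (δ ^ 2 / (4 * μ) + μ * D i k ^ 2) = (d:ℝ) ^ 2 * (δ ^ 2 / (4 * μ)) + μ * F := by
    simp only [Finset.sum_add_distrib, ← Finset.mul_sum, Finset.sum_const, Finset.card_univ,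
      Fintype.card_fin, nsmul_eq_mul]
    rw [hF, Finset.sum_comm]; ring
  have h6 : μ * F ≤ (d:ℝ) ^ 2 * (δ ^ 2 / (4 * μ)) := by linarith
  rw [le_div_iff₀ (by positivity)]
  have h7 : (d:ℝ) ^ 2 * (δ ^ 2 / (4 * μ)) * (4 * μ) = (d:ℝ) ^ 2 * δ ^ 2 := by field_simp
  have h8 := mul_le_mul_of_nonneg_right h6 (show 0 ≤ 4 * μ by positivity)
  rw [h7] at h8
  rw [← hμ2]
  linarith

lemma psi_tangent (K r r' : ℝ) :
    (1 - Real.exp (-K * r')) ≤ (1 - Real.exp (-K * r)) + K * Real.exp (-K * r) * (r' - r) := by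
  have h := Real.add_one_le_exp (-K * (r' - r))
  have h2 : Real.exp (-K * r') = Real.exp (-K * r) * Real.exp (-K * (r' - r)) := by
    rw [← Real.exp_add]; ring_nf
  have h3 := mul_le_mul_of_nonneg_left h (Real.exp_pos (-K * r)).le
  rw [h2]
  linarith

lemma norm_add_le' {d : ℕ} (z w : Ed d) (hz : 0 < ‖z‖) :
    ‖z + w‖ ≤ ‖z‖ + ⟪z, w⟫ / ‖z‖ + ‖w‖ ^ 2 / (2 * ‖z‖) := by
  have h1 : ‖z + w‖ ^ 2 = ‖z‖ ^ 2 + 2 * ⟪z, w⟫ + ‖w‖ ^ 2 := norm_add_sq_real z w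
  have h2 : 2 * ‖z‖ * ‖z + w‖ ≤ 2 * ‖z‖ ^ 2 + 2 * ⟪z, w⟫ + ‖w‖ ^ 2 := by
    nlinarith [sq_nonneg (‖z + w‖ - ‖z‖)]
  have h3 : ‖z‖ + ⟪z, w⟫ / ‖z‖ + ‖w‖ ^ 2 / (2 * ‖z‖) =
      (2 * ‖z‖ ^ 2 + 2 * ⟪z, w⟫ + ‖w‖ ^ 2) / (2 * ‖z‖) := by field_simp
  rw [h3, le_div_iff₀ (by positivity)]
  linarith

/-- second difference of `ψ(|·|)` in a general direction -/
lemma psi_second {d : ℕ} (K : ℝ) (hK : 0 ≤ K) (z w : Ed d) (hz : 0 < ‖z‖) (τ : ℝ) :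
    (1 - Real.exp (-K * ‖z + τ • w‖)) + (1 - Real.exp (-K * ‖z + (-τ) • w‖))
      - 2 * (1 - Real.exp (-K * ‖z‖)) ≤
    (K * Real.exp (-K * ‖z‖) * (‖w‖ ^ 2 / ‖z‖)) * τ ^ 2 := by
  have h1 := psi_tangent K ‖z‖ ‖z + τ • w‖
  have h2 := psi_tangent K ‖z‖ ‖z + (-τ) • w‖
  have n1 := norm_add_le' z (τ • w) hz
  have n2 := norm_add_le' z ((-τ) • w) hz
  rw [inner_smul_right, norm_smul, mul_pow, Real.norm_eq_abs, sq_abs] at n1 n2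
  have hE : 0 ≤ K * Real.exp (-K * ‖z‖) := by positivity
  have h3 : ‖z + τ • w‖ - ‖z‖ + (‖z + (-τ) • w‖ - ‖z‖) ≤ ‖w‖ ^ 2 / ‖z‖ * τ ^ 2 := by
    have e : ‖w‖ ^ 2 / ‖z‖ * τ ^ 2 = τ ^ 2 * ‖w‖ ^ 2 / (2 * ‖z‖) + (-τ) ^ 2 * ‖w‖ ^ 2 / (2 * ‖z‖) := by
      field_simp; ring
    have e2 : τ * ⟪z, w⟫ / ‖z‖ + -τ * ⟪z, w⟫ / ‖z‖ = 0 := by ring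
    linarith
  have h4 := mul_le_mul_of_nonneg_left h3 hE
  linarith

lemma two_cosh_ge (s : ℝ) : 2 + s ^ 2 ≤ Real.exp s + Real.exp (-s) := by
  have main : ∀ s : ℝ, 0 ≤ s → 2 + s ^ 2 ≤ Real.exp s + Real.exp (-s) := by
    intro s hs
    have h1 : s / 2 ≤ Real.sinh (s / 2) := Real.self_le_sinh_iff.2 (by linarith)
    rw [Real.sinh_eq] at h1
    have e1 : Real.exp s = Real.exp (s / 2) * Real.exp (s / 2) := by
      rw [← Real.exp_add]; ring_nf
    have e2 : Real.exp (-s) = Real.exp (-(s / 2)) * Real.exp (-(s / 2)) := by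
      rw [← Real.exp_add]; ring_nf
    have e3 : Real.exp (s / 2) * Real.exp (-(s / 2)) = 1 := by
      rw [← Real.exp_add]; simp
    rw [e1, e2]
    nlinarith
  rcases le_total 0 s with hs | hs
  · exact main s hs
  · have := main (-s) (by linarith)
    simp only [neg_neg, even_two, Even.neg_pow] at this
    linarith

/-- second difference of `ψ(|·|)` in the radial direction -/
lemma psi_second_radial {d : ℕ} (K : ℝ) (z : Ed d) (hz : 0 < ‖z‖) (c τ : ℝ)
    (hτ : |τ * c| ≤ ‖z‖) :
    (1 - Real.exp (-K * ‖z + τ • (c • (‖z‖⁻¹ • z))‖)) +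
      (1 - Real.exp (-K * ‖z + (-τ) • (c • (‖z‖⁻¹ • z))‖))
      - 2 * (1 - Real.exp (-K * ‖z‖)) ≤
    (- (K ^ 2 * Real.exp (-K * ‖z‖) * c ^ 2)) * τ ^ 2 := by
  have key : ∀ s : ℝ, |s| ≤ ‖z‖ → ‖z + s • (‖z‖⁻¹ • z)‖ = ‖z‖ + s := by
    intro s hs
    have e : z + s • (‖z‖⁻¹ • z) = (1 + s * ‖z‖⁻¹) • z := by
      rw [add_smul, one_smul, mul_smul]
    rw [e, norm_smul, Real.norm_eq_abs, abs_of_nonneg]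
    · field_simp
    · have h1 := (abs_le.1 hs).1
      have : 1 + s * ‖z‖⁻¹ = (‖z‖ + s) / ‖z‖ := by field_simp
      rw [this]
      apply div_nonneg <;> linarith
  rw [smul_smul τ c, smul_smul (-τ) c, key _ hτ, key (-τ * c) (by rwa [neg_mul, abs_neg])]
  have h1 := two_cosh_ge (K * (τ * c))
  have e1 : Real.exp (-K * (‖z‖ + τ * c)) = Real.exp (-K * ‖z‖) * Real.exp (-(K * (τ * c))) := by
    rw [← Real.exp_add]; ring_nf
  have e2 : Real.exp (-K * (‖z‖ + -τ * c)) = Real.exp (-K * ‖z‖) * Real.exp (K * (τ * c)) := by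
    rw [← Real.exp_add]; ring_nf
  rw [e1, e2]
  have h2 := mul_le_mul_of_nonneg_left h1 (Real.exp_pos (-K * ‖z‖)).le
  nlinarith

/-- first difference of `ψ(|·|)` -/
lemma psi_first {d : ℕ} (K : ℝ) (hK : 0 ≤ K) (z w : Ed d) (hz : 0 < ‖z‖) (τ : ℝ) :
    (1 - Real.exp (-K * ‖z + τ • w‖)) - (1 - Real.exp (-K * ‖z‖)) ≤
    (K * Real.exp (-K * ‖z‖) * (⟪z, w⟫ / ‖z‖)) * τ +
      (K * Real.exp (-K * ‖z‖) * (‖w‖ ^ 2 / (2 * ‖z‖))) * τ ^ 2 := by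
  have h1 := psi_tangent K ‖z‖ ‖z + τ • w‖
  have n1 := norm_add_le' z (τ • w) hz
  rw [inner_smul_right, norm_smul, mul_pow, Real.norm_eq_abs, sq_abs] at n1
  have hE : 0 ≤ K * Real.exp (-K * ‖z‖) := by positivity
  have h3 : ‖z + τ • w‖ - ‖z‖ ≤ ⟪z, w⟫ / ‖z‖ * τ + ‖w‖ ^ 2 / (2 * ‖z‖) * τ ^ 2 := by
    have e : ‖w‖ ^ 2 / (2 * ‖z‖) * τ ^ 2 = τ ^ 2 * ‖w‖ ^ 2 / (2 * ‖z‖) := by ring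
    have e2 : τ * ⟪z, w⟫ / ‖z‖ = ⟪z, w⟫ / ‖z‖ * τ := by ring
    linarith
  have h4 := mul_le_mul_of_nonneg_left h3 hE
  linarith

lemma b_mono {d : ℕ} (H : Hypotheses d) (t : ℝ) (ht : 0 ≤ t) (x y : Ed d) :
    ⟪x - y, H.b t x - H.b t y⟫ ≤ H.r₀ * ‖x - y‖ ^ 2 := by
  set g : ℝ → ℝ := fun τ => ⟪x - y, H.b t (y + τ • (x - y))⟫ with hg
  have hd : ∀ τ, HasDerivAt g ⟪x - y, fderiv ℝ (H.b t) (y + τ • (x - y)) (x - y)⟫ τ := by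
    intro τ
    have h1 : HasDerivAt (fun τ : ℝ => y + τ • (x - y)) (x - y) τ := by
      simpa using ((hasDerivAt_id τ).smul_const (x - y)).const_add y
    have h2 := (H.b_diff t ht (y + τ • (x - y))).hasFDerivAt.comp_hasDerivAt τ h1
    have h3 := (hasDerivAt_const τ (x - y)).inner ℝ h2
    simpa using h3
  obtain ⟨c, hc, hc'⟩ := exists_hasDerivAt_eq_slope g _ (zero_lt_one)
    (fun τ _ => (hd τ).continuousAt.continuousWithinAt) (fun τ _ => hd τ)
  have h4 := H.b_dissip t ht (y + c • (x - y)) (x - y)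
  rw [real_inner_comm] at h4
  rw [hc'] at h4
  simp only [hg] at h4
  simp only [one_smul, zero_smul, add_zero, sub_zero, div_one, add_sub_cancel] at h4
  rw [inner_sub_right]
  exact h4

def qf {d : ℕ} (Q : Matrix (Fin d) (Fin d) ℝ) (e : Fin d → ℝ) : ℝ :=
  ∑ i, ∑ j, Q i j * e i * e j

lemma grad_le {d : ℕ} (H : Hypotheses d) (t : ℝ) (ht : 0 ≤ t) (x : Ed d) (i j : Fin d) :
    ‖gradient (fun z => H.q t z i j) x‖ ≤ H.c₀ * H.η t x := by
  refine le_trans ?_ (H.gradQ_bdd t ht x)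
  apply Real.le_sqrt_of_sq_le
  calc ‖gradient (fun z => H.q t z i j) x‖ ^ 2
      ≤ ∑ j', ‖gradient (fun z => H.q t z i j') x‖ ^ 2 :=
        Finset.single_le_sum (f := fun j' => ‖gradient (fun z => H.q t z i j') x‖ ^ 2)
          (fun _ _ => sq_nonneg _) (Finset.mem_univ j)
    _ ≤ _ := Finset.single_le_sum
          (f := fun i' => ∑ j', ‖gradient (fun z => H.q t z i' j') x‖ ^ 2)
          (fun _ _ => Finset.sum_nonneg fun _ _ => sq_nonneg _) (Finset.mem_univ i)

lemma q_line {d : ℕ} (H : Hypotheses d) (t : ℝ) (ht : 0 ≤ t) (x v : Ed d) (i j : Fin d) (τ : ℝ) :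
    HasDerivAt (fun τ : ℝ => H.q t (x + τ • v) i j)
      ⟪gradient (fun z => H.q t z i j) (x + τ • v), v⟫ τ := by
  have h1 : HasDerivAt (fun τ : ℝ => x + τ • v) v τ := by
    simpa using ((hasDerivAt_id τ).smul_const v).const_add x
  have h2 := (H.q_diff t ht i j (x + τ • v)).hasFDerivAt.comp_hasDerivAt τ h1
  have h3 : ⟪gradient (fun z => H.q t z i j) (x + τ • v), v⟫ =
      fderiv ℝ (fun z => H.q t z i j) (x + τ • v) v := by simp [gradient]
  rw [h3]
  exact h2

lemma ell {d : ℕ} (H : Hypotheses d) (t : ℝ) (ht : 0 ≤ t) (x : Ed d) (e : Fin d → ℝ) :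
    H.η t x * ∑ i, e i ^ 2 ≤ qf (H.q t x) e := by
  have := H.ellipticity t ht x (WithLp.toLp 2 e)
  rw [EuclideanSpace.norm_sq_eq] at this
  simpa [qf] using this

lemma qf_gronwall {d : ℕ} (H : Hypotheses d) (t : ℝ) (ht : 0 ≤ t) (x v : Ed d) (e : Fin d → ℝ)
    (τ : ℝ) (hτ : 0 ≤ τ) :
    qf (H.q t (x + τ • v)) e ≤ Real.exp ((d:ℝ) ^ 2 * H.c₀ * ‖v‖ * τ) * qf (H.q t x) e ∧
    qf (H.q t x) e ≤ Real.exp ((d:ℝ) ^ 2 * H.c₀ * ‖v‖ * τ) * qf (H.q t (x + τ • v)) e := by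
  set g : ℝ → ℝ := fun τ => qf (H.q t (x + τ • v)) e with hg
  set g' : ℝ → ℝ := fun τ => ∑ i, ∑ j,
    ⟪gradient (fun z => H.q t z i j) (x + τ • v), v⟫ * e i * e j with hg'
  set k := (d:ℝ) ^ 2 * H.c₀ * ‖v‖ with hk
  have hd : ∀ τ, HasDerivAt g (g' τ) τ := by
    intro τ
    simp only [hg, hg', qf]
    refine HasDerivAt.fun_sum fun i _ => HasDerivAt.fun_sum fun j _ => ?_
    exact ((q_line H t ht x v i j τ).mul_const (e i)).mul_const (e j)
  have hb : ∀ τ, |g' τ| ≤ k * g τ := by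
    intro τ
    set S := ∑ i, e i ^ 2 with hS
    have hS0 : 0 ≤ S := Finset.sum_nonneg fun _ _ => sq_nonneg _
    have hei : ∀ i, e i ^ 2 ≤ S := fun i =>
      Finset.single_le_sum (f := fun i => e i ^ 2) (fun _ _ => sq_nonneg _) (Finset.mem_univ i)
    have hη : 0 ≤ H.η t (x + τ • v) := H.hη₀.le.trans (H.η_lb t ht _)
    have hterm : ∀ i j, |⟪gradient (fun z => H.q t z i j) (x + τ • v), v⟫ * e i * e j| ≤
        H.c₀ * H.η t (x + τ • v) * ‖v‖ * S := by
      intro i j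
      rw [mul_assoc, abs_mul]
      have h1 : |⟪gradient (fun z => H.q t z i j) (x + τ • v), v⟫| ≤
          H.c₀ * H.η t (x + τ • v) * ‖v‖ :=
        (abs_real_inner_le_norm _ _).trans
          (mul_le_mul_of_nonneg_right (grad_le H t ht _ i j) (norm_nonneg _))
      have h2 : |e i * e j| ≤ S := by
        rw [abs_le]
        constructor <;> nlinarith [hei i, hei j, sq_nonneg (e i - e j), sq_nonneg (e i + e j)]
      exact mul_le_mul h1 h2 (abs_nonneg _) ((abs_nonneg _).trans h1)
    have h3 : |g' τ| ≤ ∑ i : Fin d, ∑ j : Fin d, H.c₀ * H.η t (x + τ • v) * ‖v‖ * S :=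
      (Finset.abs_sum_le_sum_abs _ _).trans (Finset.sum_le_sum fun i _ =>
        (Finset.abs_sum_le_sum_abs _ _).trans (Finset.sum_le_sum fun j _ => hterm i j))
    have h4 := ell H t ht (x + τ • v) e
    have h5 : 0 ≤ k := by rw [hk]; have := H.hc₀; positivity
    have h6 := mul_le_mul_of_nonneg_left h4 h5
    simp only [Finset.sum_const, Finset.card_univ, Fintype.card_fin, nsmul_eq_mul] at h3
    have h7 : (d:ℝ) * ((d:ℝ) * (H.c₀ * H.η t (x + τ • v) * ‖v‖ * S)) =
        k * (H.η t (x + τ • v) * S) := by rw [hk]; ring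
    rw [h7] at h3
    exact h3.trans h6
  have hexp : ∀ (c τ : ℝ), HasDerivAt (fun τ : ℝ => Real.exp (c * τ)) (Real.exp (c * τ) * c) τ := by
    intro c τ
    have := ((hasDerivAt_id τ).const_mul c).exp
    simpa using this
  have hm1 : Monotone (fun τ => Real.exp (k * τ) * g τ) := by
    apply monotone_of_hasDerivAt_nonneg (fun τ => (hexp k τ).mul (hd τ))
    intro τ
    have := (abs_le.1 (hb τ)).1
    have hp := Real.exp_pos (k * τ)
    show 0 ≤ Real.exp (k * τ) * k * g τ + Real.exp (k * τ) * g' τ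
    nlinarith
  have hm2 : Antitone (fun τ => Real.exp (-k * τ) * g τ) := by
    apply antitone_of_hasDerivAt_nonpos (fun τ => (hexp (-k) τ).mul (hd τ))
    intro τ
    have := (abs_le.1 (hb τ)).2
    have hp := Real.exp_pos (-k * τ)
    show Real.exp (-k * τ) * (-k) * g τ + Real.exp (-k * τ) * g' τ ≤ 0
    nlinarith
  have a1 := hm1 hτ
  have a2 := hm2 hτ
  simp only [mul_zero, Real.exp_zero, one_mul] at a1 a2
  have hg0 : g 0 = qf (H.q t x) e := by simp [hg]
  rw [hg0] at a1 a2
  refine ⟨?_, a1⟩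
  have e1 : g τ = Real.exp (k * τ) * (Real.exp (-k * τ) * g τ) := by
    rw [← mul_assoc, ← Real.exp_add]; simp
  show g τ ≤ _
  rw [e1]
  exact mul_le_mul_of_nonneg_left a2 (Real.exp_pos _).le

lemma q_pair {d : ℕ} (H : Hypotheses d) (R : ℝ) (hR : 0 < R) :
    ∃ mm > (0:ℝ), ∃ Kq ≥ (0:ℝ), ∀ t ≥ (0:ℝ), ∀ x y : Ed d, x ≠ y → ‖x - y‖ ≤ R →
      ∃ m ≥ mm, (∀ e : Fin d → ℝ, 2 * m * ∑ i, e i ^ 2 ≤ qf (H.q t x) e) ∧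
        (∀ e : Fin d → ℝ, 2 * m * ∑ i, e i ^ 2 ≤ qf (H.q t y) e) ∧
        ∀ i j, |H.q t x i j - H.q t y i j| ≤ Kq * ‖x - y‖ * m := by
  set k := (d:ℝ) ^ 2 * H.c₀ with hk
  have hc₀ := H.hc₀
  have hk0 : 0 ≤ k := by positivity
  set E := Real.exp (k * R) with hE
  have hE0 : 0 < E := Real.exp_pos _
  have hE1 : 1 ≤ E := Real.one_le_exp (by positivity)
  have hη₀ := H.hη₀
  refine ⟨H.η₀ / (2 * E), by positivity, 2 * H.c₀ * E ^ 2, by positivity, ?_⟩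
  intro t ht x y hxy hr
  set v := y - x with hv
  have hvn : ‖v‖ = ‖x - y‖ := norm_sub_rev _ _
  have hx1 : ‖v‖ ≤ R := by rw [hvn]; exact hr
  -- minimal direction at `x`
  have hne : (sphere (0 : Ed d) 1).Nonempty := by
    refine ⟨‖v‖⁻¹ • v, ?_⟩
    have : v ≠ 0 := sub_ne_zero.2 (Ne.symm hxy)
    simp [norm_smul, this]
  have hcont : Continuous (fun e : Ed d => qf (H.q t x) e) := by
    unfold qf; fun_prop
  obtain ⟨e0, he0, hmin⟩ := (isCompact_sphere (0 : Ed d) 1).exists_isMinOn hne hcont.continuousOn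
  have he0n : ∑ i, e0 i ^ 2 = 1 := by
    have := EuclideanSpace.real_norm_sq_eq e0
    rw [mem_sphere_zero_iff_norm.1 he0] at this
    linarith
  set m0 := qf (H.q t x) e0 with hm0
  have hm0η : H.η₀ ≤ m0 := by
    have h1 := ell H t ht x e0
    rw [he0n, mul_one] at h1
    exact (H.η_lb t ht x).trans h1
  have hQx : ∀ e : Fin d → ℝ, m0 * ∑ i, e i ^ 2 ≤ qf (H.q t x) e := by
    intro e
    set S := ∑ i, e i ^ 2 with hS
    have hSn : ‖(WithLp.toLp 2 e : Ed d)‖ ^ 2 = S := by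
      rw [EuclideanSpace.real_norm_sq_eq]
    rcases eq_or_ne (WithLp.toLp 2 e : Ed d) 0 with h0 | h0
    · have : S = 0 := by rw [← hSn, h0]; simp
      rw [this, mul_zero]
      have h1 := ell H t ht x e
      rw [← hS, this, mul_zero] at h1
      exact h1
    · set n := ‖(WithLp.toLp 2 e : Ed d)‖ with hn
      have hn0 : 0 < n := norm_pos_iff.2 h0
      have h1 := hmin (show n⁻¹ • (WithLp.toLp 2 e : Ed d) ∈ sphere (0 : Ed d) 1 by
        rw [mem_sphere_zero_iff_norm, norm_smul, norm_inv, Real.norm_of_nonneg hn0.le, ← hn]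
        exact inv_mul_cancel₀ hn0.ne')
      have h2 : qf (H.q t x) (n⁻¹ • (WithLp.toLp 2 e : Ed d)) = n⁻¹ ^ 2 * qf (H.q t x) e := by
        simp only [qf, Finset.mul_sum]
        refine Finset.sum_congr rfl fun i _ => Finset.sum_congr rfl fun j _ => ?_
        simp; ring
      have h3 : m0 ≤ n⁻¹ ^ 2 * qf (H.q t x) e := by rw [← h2]; exact h1
      rw [← hSn]
      calc m0 * n ^ 2 ≤ (n⁻¹ ^ 2 * qf (H.q t x) e) * n ^ 2 :=
            mul_le_mul_of_nonneg_right h3 (sq_nonneg _)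
        _ = _ := by field_simp
  have hexp : ∀ τ, 0 ≤ τ → τ ≤ 1 → Real.exp (k * ‖v‖ * τ) ≤ E := by
    intro τ h0 h1
    apply Real.exp_le_exp.2
    have : ‖v‖ * τ ≤ R := by nlinarith [norm_nonneg v]
    nlinarith
  have hm00 : 0 < m0 := H.hη₀.trans_le hm0η
  have hyv : x + (1:ℝ) • v = y := by simp [hv]
  have hQy : ∀ e : Fin d → ℝ, m0 / E * ∑ i, e i ^ 2 ≤ qf (H.q t y) e := by
    intro e
    have h1 := (qf_gronwall H t ht x v e 1 zero_le_one).2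
    rw [hyv] at h1
    have hy0 : 0 ≤ qf (H.q t y) e := by
      refine le_trans ?_ (ell H t ht y e)
      exact mul_nonneg (H.hη₀.le.trans (H.η_lb t ht y)) (Finset.sum_nonneg fun _ _ => sq_nonneg _)
    have h2 := mul_le_mul_of_nonneg_right (hexp 1 zero_le_one le_rfl) hy0
    have h3 := (hQx e).trans (h1.trans h2)
    rw [div_mul_eq_mul_div, div_le_iff₀ hE0]
    linarith
  refine ⟨m0 / (2 * E), ?_, ?_, ?_, ?_⟩
  · show _ / _ ≤ _ / _
    gcongr
  · intro e
    refine le_trans ?_ (hQx e)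
    have : 0 ≤ ∑ i, e i ^ 2 := Finset.sum_nonneg fun _ _ => sq_nonneg _
    apply mul_le_mul_of_nonneg_right _ this
    rw [show 2 * (m0 / (2 * E)) = m0 / E by field_simp]
    exact div_le_self hm00.le hE1
  · intro e
    rw [show 2 * (m0 / (2 * E)) = m0 / E by field_simp]
    exact hQy e
  · intro i j
    obtain ⟨c, hc, hc'⟩ := exists_hasDerivAt_eq_slope (fun τ : ℝ => H.q t (x + τ • v) i j) _
      (zero_lt_one)
      (fun τ _ => (q_line H t ht x v i j τ).continuousAt.continuousWithinAt)
      (fun τ _ => q_line H t ht x v i j τ)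
    simp only [hyv, zero_smul, add_zero, sub_zero, div_one] at hc'
    rw [abs_sub_comm, ← hc']
    have h1 := grad_le H t ht (x + c • v) i j
    have h2 := abs_real_inner_le_norm (gradient (fun z => H.q t z i j) (x + c • v)) v
    have h3 : H.η t (x + c • v) ≤ E * m0 := by
      have h4 := ell H t ht (x + c • v) e0
      rw [he0n, mul_one] at h4
      have h5 := (qf_gronwall H t ht x v e0 c hc.1.le).1
      exact h4.trans (h5.trans (mul_le_mul_of_nonneg_right (hexp c hc.1.le hc.2.le) hm00.le))
    calc _ ≤ ‖gradient (fun z => H.q t z i j) (x + c • v)‖ * ‖v‖ := h2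
      _ ≤ (H.c₀ * (E * m0)) * ‖v‖ := by gcongr; exact h1.trans (by gcongr)
      _ = _ := by rw [hvn]; field_simp

lemma norm_colv_sq {d : ℕ} (S : Matrix (Fin d) (Fin d) ℝ) (k : Fin d) :
    ‖colv S k‖ ^ 2 = ∑ i, S i k ^ 2 := by
  rw [EuclideanSpace.real_norm_sq_eq]; rfl

/-- Splitting of the second order part along a decomposition `Q = S Sᵀ + T Tᵀ`. -/
lemma second_split {d : ℕ} (B : Ed d →L[ℝ] Ed d →L[ℝ] ℝ) (Q S T : Matrix (Fin d) (Fin d) ℝ)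
    (h : S * S.transpose + T * T.transpose = Q) :
    ∑ i, ∑ j, Q i j * B (EuclideanSpace.single i 1) (EuclideanSpace.single j 1) =
      ∑ k, B (colv S k) (colv S k) + ∑ k, B (colv T k) (colv T k) := by
  rw [sum_colv, sum_colv, ← h]
  simp only [Matrix.add_apply, add_mul, Finset.sum_add_distrib]

lemma qf_sub_smul_one {d : ℕ} (Q : Matrix (Fin d) (Fin d) ℝ) (m : ℝ) (e : Fin d → ℝ) :
    ∑ i, ∑ j, (Q - m • (1 : Matrix (Fin d) (Fin d) ℝ)) i j * e i * e j =
      qf Q e - m * ∑ i, e i ^ 2 := by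
  simp only [Matrix.sub_apply, Matrix.smul_apply, Matrix.one_apply, smul_eq_mul, mul_ite, mul_one,
    mul_zero, sub_mul, ite_mul, zero_mul, Finset.sum_sub_distrib, Finset.sum_ite_eq,
    Finset.mem_univ, if_true, qf, Finset.mul_sum]
  congr 1
  exact Finset.sum_congr rfl fun i _ => by ring

lemma core {d : ℕ} (H : Hypotheses d) (R : ℝ) (hR : 0 < R) :
    ∃ K > (0:ℝ), ∃ c₁ > (0:ℝ), ∀ t ≥ (0:ℝ), ∀ x y : Ed d, x ≠ y → ‖x - y‖ ≤ R →
      ∀ P N : Ed d → ℝ, ContDiff ℝ 2 P → ContDiff ℝ 2 N → ∀ c ≥ (0:ℝ),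
      (∀ x' y', P x' - N y' - c * (1 - Real.exp (-K * ‖x' - y'‖)) ≤
        P x - N y - c * (1 - Real.exp (-K * ‖x - y‖))) →
      applyA H.q H.b t P x - applyA H.q H.b t N y ≤ -(c * c₁) := by
  obtain ⟨mm, hmm, Kq, hKq, hpair⟩ := q_pair H R hR
  set K₂ := (d:ℝ) ^ 2 * Kq ^ 2 / 4 with hK₂
  have hK₂0 : 0 ≤ K₂ := by positivity
  set K := 1 + (K₂ * R + |H.r₀| * R / mm) / 4 with hK
  have hK0 : 0 < K := by positivity
  refine ⟨K, hK0, 4 * K * Real.exp (-K * R) * mm, by positivity, ?_⟩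
  intro t ht x y hxy hr P N hP hN c hc hmax
  obtain ⟨m, hm, hQx, hQy, hdiff⟩ := hpair t ht x y hxy hr
  have hm0 : 0 < m := hmm.trans_le hm
  have hz : 0 < ‖x - y‖ := norm_pos_iff.2 (sub_ne_zero.2 hxy)
  set z := x - y with hzdef
  set E := Real.exp (-K * ‖z‖) with hE
  have hE0 : 0 < E := Real.exp_pos _
  have hsymm : ∀ x, (H.q t x - m • (1 : Matrix (Fin d) (Fin d) ℝ)).IsSymm := fun x =>
    (H.q_symm t ht x).sub (Matrix.isSymm_one.smul m)
  obtain ⟨S, hSs, hSS, hSm⟩ := exists_sqrt (H.q t x - m • 1) (hsymm x) m hm0.le (by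
    intro v; rw [qf_sub_smul_one]; linarith [hQx v])
  obtain ⟨T, hTs, hTT, hTm⟩ := exists_sqrt (H.q t y - m • 1) (hsymm y) m hm0.le (by
    intro v; rw [qf_sub_smul_one]; linarith [hQy v])
  have hF := sqrt_lip S T hSs hTs m hm0 hSm hTm (Kq * ‖z‖ * m) (by
    intro i j
    rw [hSS, hTT]
    simpa using hdiff i j)
  -- reflection
  set ξ : Ed d := ‖z‖⁻¹ • z with hξ
  have hξn : ∑ i, ξ i ^ 2 = 1 := by
    rw [← EuclideanSpace.real_norm_sq_eq, hξ, norm_smul, norm_inv, norm_norm,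
      inv_mul_cancel₀ hz.ne']; norm_num
  set I' : Matrix (Fin d) (Fin d) ℝ := Real.sqrt m • 1 with hI'
  set R' : Matrix (Fin d) (Fin d) ℝ :=
    Real.sqrt m • ((1 : Matrix (Fin d) (Fin d) ℝ) - (2:ℝ) • Matrix.vecMulVec (fun i => ξ i) (fun i => ξ i))
    with hR'
  have hsm : Real.sqrt m * Real.sqrt m = m := Real.mul_self_sqrt hm0.le
  have hI'2 : I' * I'.transpose = m • (1 : Matrix (Fin d) (Fin d) ℝ) := by
    rw [hI', Matrix.transpose_smul, Matrix.transpose_one, Matrix.smul_mul, Matrix.mul_smul,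
      smul_smul, hsm, Matrix.mul_one]
  have hR'2 : R' * R'.transpose = m • (1 : Matrix (Fin d) (Fin d) ℝ) := by
    have hVV : Matrix.vecMulVec (fun i => ξ i) (fun i => ξ i) *
        Matrix.vecMulVec (fun i => ξ i) (fun i => ξ i) =
        Matrix.vecMulVec (fun i => ξ i) (fun i => ξ i) := by
      ext i j
      simp only [Matrix.mul_apply, Matrix.vecMulVec_apply]
      have : ∀ k, ξ i * ξ k * (ξ k * ξ j) = ξ i * ξ j * ξ k ^ 2 := by intro k; ring
      simp only [this, ← Finset.mul_sum, hξn, mul_one]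
    have hVt : (Matrix.vecMulVec (fun i => ξ i) (fun i => ξ i)).transpose =
        Matrix.vecMulVec (fun i => ξ i) (fun i => ξ i) := by
      ext i j; simp [Matrix.vecMulVec_apply, mul_comm]
    set Vm := Matrix.vecMulVec (fun i => ξ i) (fun i => ξ i) with hVm
    rw [hR', Matrix.transpose_smul, Matrix.transpose_sub, Matrix.transpose_one,
      Matrix.transpose_smul, hVt, Matrix.smul_mul, Matrix.mul_smul, smul_smul, hsm]
    congr 1
    rw [Matrix.sub_mul, Matrix.mul_sub, Matrix.mul_sub, Matrix.one_mul, Matrix.one_mul,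
      Matrix.mul_one, Matrix.smul_mul, Matrix.mul_smul, hVV, smul_smul]
    have : ((2:ℝ) * 2) • Vm = (2:ℝ) • Vm + (2:ℝ) • Vm := by rw [← add_smul]; norm_num
    rw [this]; abel
  have hdecx : S * S.transpose + I' * I'.transpose = H.q t x := by
    rw [hSs.eq, hSS, hI'2]; abel
  have hdecy : T * T.transpose + R' * R'.transpose = H.q t y := by
    rw [hTs.eq, hTT, hR'2]; abel
  have hmove : ∀ (v w : Ed d) (τ : ℝ),
      (P (x + τ • v) - N (y + τ • w)) - (P x - N y) ≤
        c * ((1 - Real.exp (-K * ‖z + τ • (v - w)‖)) - (1 - E)) := by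
    intro v w τ
    have h1 := hmax (x + τ • v) (y + τ • w)
    have h2 : x + τ • v - (y + τ • w) = z + τ • (v - w) := by
      rw [hzdef, smul_sub]; abel
    rw [h2] at h1
    linarith
  have hsync : ∀ k, fderiv ℝ (fderiv ℝ P) x (colv S k) (colv S k) -
      fderiv ℝ (fderiv ℝ N) y (colv T k) (colv T k) ≤
      c * (K * E * (‖colv S k - colv T k‖ ^ 2 / ‖z‖)) := by
    intro k
    refine pair_second hP hN x y _ _ _ (Eventually.of_forall fun τ => ?_)
    have h1 := hmove (colv S k) (colv T k) τ
    have h2 := hmove (colv S k) (colv T k) (-τ)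
    have h3 := mul_le_mul_of_nonneg_left (psi_second K hK0.le z (colv S k - colv T k) hz τ) hc
    linarith
  have hrefl : ∀ k, fderiv ℝ (fderiv ℝ P) x (colv I' k) (colv I' k) -
      fderiv ℝ (fderiv ℝ N) y (colv R' k) (colv R' k) ≤
      c * (-(K ^ 2 * E * (4 * m * ξ k ^ 2))) := by
    intro k
    have hdir : colv I' k - colv R' k = (2 * Real.sqrt m * ξ k) • (‖z‖⁻¹ • z) := by
      rw [← hξ]
      ext i
      simp [colv, hI', hR', Matrix.vecMulVec_apply]
      ring
    refine pair_second hP hN x y _ _ _ ?_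
    have hsmall : ∀ᶠ τ in 𝓝[>] (0:ℝ), |τ * (2 * Real.sqrt m * ξ k)| ≤ ‖z‖ := by
      have : Continuous (fun τ : ℝ => |τ * (2 * Real.sqrt m * ξ k)|) := by fun_prop
      have h0 := this.tendsto 0
      simp only [zero_mul, abs_zero] at h0
      exact (h0.mono_left nhdsWithin_le_nhds).eventually (ge_mem_nhds hz)
    filter_upwards [hsmall] with τ hτ
    have h1 := hmove (colv I' k) (colv R' k) τ
    have h2 := hmove (colv I' k) (colv R' k) (-τ)
    have h3 := mul_le_mul_of_nonneg_left (psi_second_radial K z hz _ τ hτ) hc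
    rw [← hdir] at h3
    have h4 : (2 * Real.sqrt m * ξ k) ^ 2 = 4 * m * ξ k ^ 2 := by
      linear_combination (4 * ξ k ^ 2) * hsm
    rw [h4] at h3
    linarith
  have hdrift : fderiv ℝ P x (H.b t x) - fderiv ℝ N y (H.b t y) ≤
      c * (K * E * (⟪z, H.b t x - H.b t y⟫ / ‖z‖)) := by
    refine pair_first hP hN x y _ _ _
      (c * (K * E * (‖H.b t x - H.b t y‖ ^ 2 / (2 * ‖z‖)))) (Eventually.of_forall fun τ => ?_)
    have h1 := hmove (H.b t x) (H.b t y) τ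
    have h3 := mul_le_mul_of_nonneg_left (psi_first K hK0.le z (H.b t x - H.b t y) hz τ) hc
    linarith
  rw [applyA_eq, applyA_eq, second_split _ _ S I' hdecx, second_split _ _ T R' hdecy]
  have s1 := Finset.sum_le_sum (s := Finset.univ) fun k _ => hsync k
  have s2 := Finset.sum_le_sum (s := Finset.univ) fun k _ => hrefl k
  rw [Finset.sum_sub_distrib] at s1 s2
  have s1' : ∑ k, c * (K * E * (‖colv S k - colv T k‖ ^ 2 / ‖z‖)) ≤ c * (K * E * (K₂ * ‖z‖ * m)) := by
    rw [← Finset.mul_sum, ← Finset.mul_sum, ← Finset.sum_div]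
    have : ∑ k, ‖colv S k - colv T k‖ ^ 2 = ∑ k, ∑ i, (S i k - T i k) ^ 2 := by
      refine Finset.sum_congr rfl fun k _ => ?_
      rw [EuclideanSpace.real_norm_sq_eq]; rfl
    rw [this]
    have h2 : (∑ k, ∑ i, (S i k - T i k) ^ 2) / ‖z‖ ≤ K₂ * ‖z‖ * m := by
      rw [div_le_iff₀ hz]
      refine hF.trans (le_of_eq ?_)
      rw [hK₂]; field_simp
    gcongr
  have s2' : ∑ k, c * (-(K ^ 2 * E * (4 * m * ξ k ^ 2))) = -(c * (K ^ 2 * E * (4 * m))) := by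
    have : ∀ k, c * (-(K ^ 2 * E * (4 * m * ξ k ^ 2))) = -(c * (K ^ 2 * E * (4 * m))) * ξ k ^ 2 := by
      intro k; ring
    simp only [this, ← Finset.mul_sum, hξn, mul_one]
  have s3 : c * (K * E * (⟪z, H.b t x - H.b t y⟫ / ‖z‖)) ≤ c * (K * E * (|H.r₀| * R / mm * m)) := by
    have h1 : ⟪z, H.b t x - H.b t y⟫ / ‖z‖ ≤ |H.r₀| * R / mm * m := by
      rw [div_le_iff₀ hz]
      have h2 := b_mono H t ht x y
      have h3 : H.r₀ * ‖z‖ ^ 2 ≤ |H.r₀| * R * ‖z‖ := by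
        have a1 : H.r₀ ≤ |H.r₀| := le_abs_self _
        have a2 : 0 ≤ |H.r₀| := abs_nonneg _
        have a3 : H.r₀ * ‖z‖ ^ 2 ≤ |H.r₀| * ‖z‖ ^ 2 := by gcongr
        have a4 : |H.r₀| * ‖z‖ ^ 2 ≤ |H.r₀| * R * ‖z‖ := by
          rw [sq, mul_assoc]; gcongr
        linarith
      have h4 : |H.r₀| * R * ‖z‖ ≤ |H.r₀| * R / mm * m * ‖z‖ := by
        have : |H.r₀| * R ≤ |H.r₀| * R / mm * m := by
          rw [div_mul_eq_mul_div, le_div_iff₀ hmm]; gcongr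
        gcongr
      linarith
    gcongr
  have s4 : K₂ * ‖z‖ * m ≤ K₂ * R * m := by gcongr
  have s5 : K₂ * R * m + |H.r₀| * R / mm * m - K * (4 * m) = - (4 * m) := by rw [hK]; ring
  have s6 : Real.exp (-K * R) ≤ E := by
    apply Real.exp_le_exp.2; nlinarith
  have s7 : Real.exp (-K * R) * mm ≤ E * m := by gcongr
  have s8 : c * (K * E * (K₂ * ‖z‖ * m)) ≤ c * (K * E * (K₂ * R * m)) := by gcongr
  have s9 : c * (K * E * (K₂ * R * m)) + c * (K * E * (|H.r₀| * R / mm * m)) -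
      c * (K ^ 2 * E * (4 * m)) = -(c * (4 * K * (E * m))) := by
    linear_combination (c * K * E) * s5
  have s10 : c * (4 * K * (Real.exp (-K * R) * mm)) ≤ c * (4 * K * (E * m)) := by gcongr
  rw [s2'] at s2
  linarith

lemma pair_max {d : ℕ} (H : Hypotheses d) (t : ℝ) (ht : 0 ≤ t) (x y : Ed d)
    (P N : Ed d → ℝ) (hP : ContDiff ℝ 2 P) (hN : ContDiff ℝ 2 N)
    (hmax : ∀ x' y', P x' - N y' ≤ P x - N y) :
    applyA H.q H.b t P x - applyA H.q H.b t N y ≤ 0 := by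
  have hq0 : ∀ x, ∀ v : Fin d → ℝ, 0 * ∑ i, v i ^ 2 ≤ ∑ i, ∑ j, H.q t x i j * v i * v j := by
    intro x v
    have h1 := ell H t ht x v
    have h2 : 0 ≤ H.η t x * ∑ i, v i ^ 2 :=
      mul_nonneg (H.hη₀.le.trans (H.η_lb t ht x)) (Finset.sum_nonneg fun _ _ => sq_nonneg _)
    rw [zero_mul]
    exact h2.trans h1
  obtain ⟨S, hSs, hSS, -⟩ := exists_sqrt (H.q t x) (H.q_symm t ht x) 0 le_rfl (hq0 x)
  obtain ⟨T, hTs, hTT, -⟩ := exists_sqrt (H.q t y) (H.q_symm t ht y) 0 le_rfl (hq0 y)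
  have h2 : ∀ k, fderiv ℝ (fderiv ℝ P) x (colv S k) (colv S k) -
      fderiv ℝ (fderiv ℝ N) y (colv T k) (colv T k) ≤ 0 := by
    intro k
    refine pair_second hP hN x y _ _ _ (Eventually.of_forall fun τ => ?_)
    have h1 := hmax (x + τ • colv S k) (y + τ • colv T k)
    have h2 := hmax (x + (-τ) • colv S k) (y + (-τ) • colv T k)
    linarith
  have h1 : fderiv ℝ P x (H.b t x) - fderiv ℝ N y (H.b t y) ≤ 0 := by
    refine pair_first hP hN x y _ _ _ 0 (Eventually.of_forall fun τ => ?_)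
    have h1 := hmax (x + τ • H.b t x) (y + τ • H.b t y)
    linarith
  have s := Finset.sum_le_sum (s := Finset.univ) fun k _ => h2 k
  rw [Finset.sum_sub_distrib, sum_colv, sum_colv, hSs.eq, hTs.eq, hSS, hTT] at s
  simp only [Finset.sum_const_zero] at s
  rw [applyA_eq, applyA_eq]
  linarith

lemma left_max_deriv {g : ℝ → ℝ} {D s t : ℝ} (hst : s < t) (hg : HasDerivAt g D t)
    (h : ∀ τ, s ≤ τ → τ ≤ t → g τ ≤ g t) : 0 ≤ D := by
  have h0 : Tendsto (slope g t) (𝓝[<] t) (𝓝 D) :=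
    hg.tendsto_slope.mono_left (nhdsWithin_mono _ (fun x hx => ne_of_lt hx))
  refine ge_of_tendsto h0 ?_
  filter_upwards [Ioo_mem_nhdsLT hst] with τ hτ
  rw [slope_def_field]
  exact div_nonneg_of_nonpos (by linarith [h τ hτ.1.le hτ.2.le]) (by linarith [hτ.2])

lemma V_large {d : ℕ} (H : Hypotheses d) (L : ℝ) : ∃ ρ ≥ (0:ℝ), ∀ x, ρ ≤ ‖x‖ → L ≤ H.V x := by
  have h := H.V_tendsto.eventually (eventually_ge_atTop L)
  rw [eventually_comap, eventually_atTop] at h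
  obtain ⟨ρ, hρ⟩ := h
  exact ⟨max ρ 0, le_max_right _ _, fun x hx => hρ ‖x‖ ((le_max_left _ _).trans hx) x rfl⟩

lemma V_lower {d : ℕ} (H : Hypotheses d) : ∃ v0 > (0:ℝ), ∀ x, v0 ≤ H.V x := by
  obtain ⟨ρ, hρ, h⟩ := V_large H 1
  obtain ⟨x0, -, hmin⟩ := (isCompact_closedBall (0 : Ed d) ρ).exists_isMinOn
    ⟨0, by simpa using hρ⟩ H.V_C2.continuous.continuousOn
  refine ⟨min 1 (H.V x0), lt_min one_pos (H.V_pos x0), fun x => ?_⟩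
  rcases le_total ρ ‖x‖ with hx | hx
  · exact (min_le_left _ _).trans (h x hx)
  · exact (min_le_right _ _).trans (hmin (by simpa using hx))

set_option maxHeartbeats 2000000 in
lemma decay {d : ℕ} (H : Hypotheses d) (s : ℝ) (hs : 0 ≤ s) (f : Ed d → ℝ) (u : ℝ → Ed d → ℝ)
    (hu : IsBoundedClassicalSolution H.q H.b s f u) :
    ∃ lam > (0:ℝ), ∃ B > (0:ℝ), ∃ ε > (0:ℝ), ∀ t ≥ s, ∀ x y,
      u t x - u t y ≤ B * Real.exp (-lam * (t - s)) * (1 + ε * (H.V x + H.V y)) := by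
  obtain ⟨M, hM⟩ := hu.bdd
  have ha := H.ha
  have hκ := H.hκ
  obtain ⟨ρ, hρ, hVρ⟩ := V_large H (4 * (H.a + 1) / H.κ)
  obtain ⟨v0, hv0, hVv0⟩ := V_lower H
  set R := 2 * ρ + 1 with hR
  obtain ⟨K, hK, c₁, hc₁, hcore⟩ := core H R (by positivity)
  set ε := c₁ / (4 * (H.a + 1)) with hε
  have hε0 : 0 < ε := by positivity
  have hεa : 2 * H.a * ε ≤ c₁ / 2 := by
    rw [hε]
    have : c₁ / 2 - 2 * H.a * (c₁ / (4 * (H.a + 1))) = c₁ / (2 * (H.a + 1)) := by field_simp; ring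
    have : 0 < c₁ / (2 * (H.a + 1)) := by positivity
    linarith
  set lam := min (H.κ / 4) (min (c₁ / 4) ε) with hlam
  have hlam0 : 0 < lam := lt_min (by positivity) (lt_min (by positivity) hε0)
  have hl1 : lam ≤ H.κ / 4 := min_le_left _ _
  have hl2 : lam ≤ c₁ / 4 := (min_le_right _ _).trans (min_le_left _ _)
  have hl3 : lam ≤ ε := (min_le_right _ _).trans (min_le_right _ _)
  set M' := |M| + 1 with hM'
  have hM'0 : 0 < M' := by positivity
  have hMu : ∀ t ≥ s, ∀ x, |u t x| ≤ M' := fun t ht x =>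
    (hM t ht x).trans ((le_abs_self M).trans (by linarith))
  set B := M' / (ε * v0) with hB
  have hB0 : 0 < B := by positivity
  set ψ : Ed d → Ed d → ℝ := fun x y =>
    min (1 - Real.exp (-K * ‖x - y‖)) (1 - Real.exp (-K * R)) with hψ
  have hψ0 : ∀ x y, 0 ≤ ψ x y := by
    intro x y
    apply le_min
    · rw [sub_nonneg, Real.exp_le_one_iff]
      nlinarith [norm_nonneg (x - y)]
    · rw [sub_nonneg, Real.exp_le_one_iff]
      nlinarith
  have hψ1 : ∀ x y, ψ x y ≤ 1 := by
    intro x y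
    refine (min_le_right _ _).trans ?_
    linarith [Real.exp_pos (-K * R)]
  set Φ : Ed d → Ed d → ℝ := fun x y => ψ x y + ε * (H.V x + H.V y) with hΦ
  have hVcont : Continuous H.V := H.V_C2.continuous
  have hΦcont : Continuous (fun p : Ed d × Ed d => Φ p.1 p.2) := by
    simp only [hΦ, hψ]
    fun_prop
  have hΦlow : ∀ x y, 2 * (ε * v0) ≤ Φ x y := by
    intro x y
    have h1 := hψ0 x y
    have h2 : ε * (2 * v0) ≤ ε * (H.V x + H.V y) :=
      mul_le_mul_of_nonneg_left (by linarith [hVv0 x, hVv0 y]) hε0.le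
    simp only [hΦ]; linarith
  set Z : ℝ → Ed d → Ed d → ℝ := fun t x y =>
    u t x - u t y - B * Real.exp (-lam * (t - s)) * Φ x y with hZ
  suffices hmain : ∀ t ≥ s, ∀ x y, Z t x y ≤ 0 by
    refine ⟨lam, hlam0, B, hB0, ε, hε0, fun t ht x y => ?_⟩
    have h1 := hmain t ht x y
    have h2 : B * Real.exp (-lam * (t - s)) * Φ x y ≤
        B * Real.exp (-lam * (t - s)) * (1 + ε * (H.V x + H.V y)) := by
      have := hψ1 x y
      have h3 : Φ x y ≤ 1 + ε * (H.V x + H.V y) := by simp only [hΦ]; linarith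
      gcongr
    simp only [hZ] at h1
    linarith
  by_contra hcon
  push Not at hcon
  obtain ⟨T, hT, x₁, y₁, hpos⟩ := hcon
  -- compactness
  set δ := B * Real.exp (-lam * (T - s)) * ε with hδ
  have hδ0 : 0 < δ := by positivity
  obtain ⟨ρ', hρ', hV'⟩ := V_large H (2 * M' / δ)
  have hfar : ∀ t ∈ Icc s T, ∀ x y, (ρ' ≤ ‖x‖ ∨ ρ' ≤ ‖y‖) → Z t x y ≤ 0 := by
    intro t ht x y hxy
    have hW : 2 * M' / δ ≤ H.V x + H.V y := by
      rcases hxy with h | h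
      · linarith [hV' x h, H.V_pos y]
      · linarith [hV' y h, H.V_pos x]
    have h1 : 2 * M' ≤ δ * (H.V x + H.V y) := by
      rw [div_le_iff₀ hδ0] at hW; linarith
    have h2 : Real.exp (-lam * (T - s)) ≤ Real.exp (-lam * (t - s)) := by
      apply Real.exp_le_exp.2
      nlinarith [ht.2]
    have hW0 : 0 < H.V x + H.V y := add_pos (H.V_pos x) (H.V_pos y)
    have h3 : ε * (H.V x + H.V y) ≤ Φ x y := by
      have := hψ0 x y
      simp only [hΦ]; linarith
    have h4 : B * Real.exp (-lam * (T - s)) * (ε * (H.V x + H.V y)) ≤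
        B * Real.exp (-lam * (t - s)) * Φ x y := by gcongr
    have h5 := abs_le.1 (hMu t ht.1 x)
    have h6 := abs_le.1 (hMu t ht.1 y)
    simp only [hZ]
    rw [hδ] at h1
    linarith [h5.2, h6.1]
  set C : Set (ℝ × Ed d × Ed d) := Icc s T ×ˢ (closedBall 0 ρ' ×ˢ closedBall 0 ρ') with hC
  have hCc : IsCompact C :=
    isCompact_Icc.prod ((isCompact_closedBall _ _).prod (isCompact_closedBall _ _))
  have hZc : ContinuousOn (fun p : ℝ × Ed d × Ed d => Z p.1 p.2.1 p.2.2) C := by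
    have c1 : ContinuousOn (fun p : ℝ × Ed d × Ed d => u p.1 p.2.1) C :=
      hu.cont.comp (f := fun p : ℝ × Ed d × Ed d => (p.1, p.2.1)) (by fun_prop)
        (fun p hp => ⟨hp.1.1, mem_univ _⟩)
    have c2 : ContinuousOn (fun p : ℝ × Ed d × Ed d => u p.1 p.2.2) C :=
      hu.cont.comp (f := fun p : ℝ × Ed d × Ed d => (p.1, p.2.2)) (by fun_prop)
        (fun p hp => ⟨hp.1.1, mem_univ _⟩)
    have c3 : Continuous (fun p : ℝ × Ed d × Ed d =>
        B * Real.exp (-lam * (p.1 - s)) * Φ p.2.1 p.2.2) :=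
      (by fun_prop : Continuous (fun p : ℝ × Ed d × Ed d => B * Real.exp (-lam * (p.1 - s)))).mul
        (hΦcont.comp continuous_snd)
    exact (c1.sub c2).sub c3.continuousOn
  have hmem : ∀ t ∈ Icc s T, ∀ x y, 0 < Z t x y → (t, x, y) ∈ C := by
    intro t ht x y h
    refine ⟨ht, ?_, ?_⟩
    · by_contra hx
      rw [mem_closedBall_zero_iff, not_le] at hx
      exact absurd (hfar t ht x y (Or.inl hx.le)) (not_le.2 h)
    · by_contra hx
      rw [mem_closedBall_zero_iff, not_le] at hx
      exact absurd (hfar t ht x y (Or.inr hx.le)) (not_le.2 h)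
  have hp1 := hmem T ⟨hT, le_rfl⟩ x₁ y₁ hpos
  obtain ⟨⟨t, x, y⟩, htxy, hmaxC⟩ := hCc.exists_isMaxOn ⟨_, hp1⟩ hZc
  have htI : t ∈ Icc s T := htxy.1
  have hZpos : 0 < Z t x y := hpos.trans_le (hmaxC hp1)
  have hmax : ∀ t' ∈ Icc s T, ∀ x' y', Z t' x' y' ≤ Z t x y := by
    intro t' ht' x' y'
    rcases le_or_gt (Z t' x' y') 0 with h | h
    · exact h.trans hZpos.le
    · exact hmaxC (hmem t' ht' x' y' h)
  have hxy : x ≠ y := by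
    rintro rfl
    have h1 := hΦlow x x
    have h2 : 0 < Φ x x := lt_of_lt_of_le (by positivity) h1
    have h3 : 0 < B * Real.exp (-lam * (t - s)) * Φ x x := by positivity
    simp only [hZ] at hZpos
    linarith
  have hts : s < t := by
    rcases htI.1.eq_or_lt with h | h
    · exfalso
      subst h
      simp only [hZ, sub_self, mul_zero, Real.exp_zero, mul_one] at hZpos
      have h1 := mul_le_mul_of_nonneg_left (hΦlow x y) hB0.le
      have h2 : B * (2 * (ε * v0)) = 2 * M' := by rw [hB]; field_simp
      have h5 := abs_le.1 (hMu s le_rfl x)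
      have h6 := abs_le.1 (hMu s le_rfl y)
      linarith [h5.2, h6.1]
    · exact h
  have ht0 : 0 ≤ t := hs.trans hts.le
  set c := B * Real.exp (-lam * (t - s)) with hc
  have hc0 : 0 < c := by positivity
  have hut := hu.smooth_space t hts
  -- time derivative
  have htime : 0 ≤ applyA H.q H.b t (u t) x - applyA H.q H.b t (u t) y + lam * c * Φ x y := by
    have hd : HasDerivAt (fun τ => B * Real.exp (-lam * (τ - s)) * Φ x y)
        (-(lam * c * Φ x y)) t := by
      have h1 : HasDerivAt (fun τ => -lam * (τ - s)) (-lam) t := by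
        simpa using ((hasDerivAt_id t).sub_const s).const_mul (-lam)
      have h2 := (h1.exp.const_mul B).mul_const (Φ x y)
      rw [show -(lam * c * Φ x y) = B * (Real.exp (-lam * (t - s)) * -lam) * Φ x y by
        rw [hc]; ring]
      exact h2
    have h3 := ((hu.pde t hts x).sub (hu.pde t hts y)).sub hd
    have h4 := left_max_deriv hts h3 (fun τ h1 h2 => hmax τ ⟨h1, h2.trans htI.2⟩ x y)
    linarith
  -- the functions P and N
  set P : Ed d → ℝ := fun w => u t w + (-(c * ε)) * H.V w with hP
  set N : Ed d → ℝ := fun w => u t w + (c * ε) * H.V w with hN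
  have hPC : ContDiff ℝ 2 P := hut.add (contDiff_const.mul H.V_C2)
  have hNC : ContDiff ℝ 2 N := hut.add (contDiff_const.mul H.V_C2)
  have hAP : applyA H.q H.b t P x = applyA H.q H.b t (u t) x + (-(c * ε)) * applyA H.q H.b t H.V x :=
    applyA_add _ _ _ hut H.V_C2 _ _
  have hAN : applyA H.q H.b t N y = applyA H.q H.b t (u t) y + (c * ε) * applyA H.q H.b t H.V y :=
    applyA_add _ _ _ hut H.V_C2 _ _
  have hsp : ∀ x' y', P x' - N y' - c * ψ x' y' ≤ P x - N y - c * ψ x y := by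
    intro x' y'
    have h1 := hmax t htI x' y'
    simp only [hZ, hΦ] at h1
    simp only [hP, hN]
    linarith
  have hLx := H.lyapunov t ht0 x
  have hLy := H.lyapunov t ht0 y
  set W := H.V x + H.V y with hW
  have hW0 : 0 < W := add_pos (H.V_pos x) (H.V_pos y)
  have hΦ1 : Φ x y ≤ 1 + ε * W := by
    have := hψ1 x y
    simp only [hΦ]; linarith
  have hcε : 0 < c * ε := by positivity
  have hLyap : c * ε * (applyA H.q H.b t H.V x + applyA H.q H.b t H.V y) ≤
      c * ε * (2 * H.a - H.κ * W) :=
    mul_le_mul_of_nonneg_left (by rw [hW]; linarith) hcε.le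
  have hΦ2 : lam * c * Φ x y ≤ lam * c * (1 + ε * W) :=
    mul_le_mul_of_nonneg_left hΦ1 (by positivity)
  rcases le_or_gt ‖x - y‖ R with hr | hr
  · have hmin : ψ x y = 1 - Real.exp (-K * ‖x - y‖) := by
      apply min_eq_left
      have : Real.exp (-K * R) ≤ Real.exp (-K * ‖x - y‖) := by
        apply Real.exp_le_exp.2; nlinarith
      linarith
    have h1 := hcore t ht0 x y hxy hr P N hPC hNC c hc0.le (by
      intro x' y'
      have h2 := hsp x' y'
      rw [hmin] at h2
      have h3 : ψ x' y' ≤ 1 - Real.exp (-K * ‖x' - y'‖) := min_le_left _ _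
      have h4 := mul_le_mul_of_nonneg_left h3 hc0.le
      linarith)
    rw [hAP, hAN] at h1
    have h5 : 0 ≤ c * (ε * (2 * H.a - H.κ * W) - c₁ + lam * (1 + ε * W)) := by
      have h9 : c * (ε * (2 * H.a - H.κ * W) - c₁ + lam * (1 + ε * W)) =
          c * ε * (2 * H.a - H.κ * W) - c * c₁ + lam * c * (1 + ε * W) := by ring
      rw [h9]
      linarith
    have h6 : ε * (2 * H.a - H.κ * W) - c₁ + lam * (1 + ε * W) < 0 := by
      have h7 : lam * (ε * W) ≤ H.κ * (ε * W) :=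
        mul_le_mul_of_nonneg_right (by linarith) (by positivity)
      nlinarith
    exact absurd h5 (not_le.2 (mul_neg_of_pos_of_neg hc0 h6))
  · have hmin : ψ x y = 1 - Real.exp (-K * R) := by
      apply min_eq_right
      have : Real.exp (-K * ‖x - y‖) ≤ Real.exp (-K * R) := by
        apply Real.exp_le_exp.2; nlinarith
      linarith
    have h1 := pair_max H t ht0 x y P N hPC hNC (by
      intro x' y'
      have h2 := hsp x' y'
      rw [hmin] at h2
      have h3 : ψ x' y' ≤ 1 - Real.exp (-K * R) := min_le_right _ _
      have h4 := mul_le_mul_of_nonneg_left h3 hc0.le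
      linarith)
    rw [hAP, hAN] at h1
    have hWl : 4 * (H.a + 1) ≤ H.κ * W := by
      have h2 : 4 * (H.a + 1) / H.κ ≤ W := by
        have h3 : ρ ≤ ‖x‖ ∨ ρ ≤ ‖y‖ := by
          by_contra hh
          push Not at hh
          have := norm_sub_le x y
          linarith [hh.1, hh.2]
        rcases h3 with h | h
        · linarith [hVρ x h, H.V_pos y]
        · linarith [hVρ y h, H.V_pos x]
      rw [div_le_iff₀ hκ] at h2; linarith
    have h5 : 0 ≤ c * (ε * (2 * H.a - H.κ * W) + lam * (1 + ε * W)) := by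
      have h9 : c * (ε * (2 * H.a - H.κ * W) + lam * (1 + ε * W)) =
          c * ε * (2 * H.a - H.κ * W) + lam * c * (1 + ε * W) := by ring
      rw [h9]
      linarith
    have h6 : ε * (2 * H.a - H.κ * W) + lam * (1 + ε * W) < 0 := by
      have h7 : lam * (ε * W) ≤ H.κ / 4 * (ε * W) :=
        mul_le_mul_of_nonneg_right hl1 (by positivity)
      have h8 : ε * (4 * (H.a + 1)) ≤ ε * (H.κ * W) := mul_le_mul_of_nonneg_left hWl hε0.le
      nlinarith [mul_nonneg hε0.le ha]
    exact absurd h5 (not_le.2 (mul_neg_of_pos_of_neg hc0 h6))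

/-- For every `s ≥ 0` and `f ∈ C_b(ℝ^d)`, `G(t,s)f → m_s(f)` uniformly
on every compact subset of `ℝ^d` as `t → +∞`. -/
theorem locally_uniform_convergence (d : ℕ) (H : Hypotheses d) (μ : ℝ → Measure (Ed d))
    (hsys : IsEvolutionSystem H μ) (htight : IsTightSystem μ)
    (s : ℝ) (hs : 0 ≤ s) (f : Ed d → ℝ) (hf : IsCb f) :
    ∀ K : Set (Ed d), IsCompact K →
      TendstoUniformlyOn (fun t x => H.G t s f x) (fun _ => ∫ y, f y ∂μ s) atTop K := by
  intro K hK
  have hu := H.G_sol s hs f hf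
  obtain ⟨M, hM⟩ := hu.bdd
  obtain ⟨lam, hlam, B, hB, ε, hε, hdec⟩ := decay H s hs f _ hu
  set M' := |M| + 1 with hM'
  have hM'0 : 0 < M' := by positivity
  have hMu : ∀ t ≥ s, ∀ x, |H.G t s f x| ≤ M' := fun t ht x =>
    (hM t ht x).trans ((le_abs_self M).trans (by linarith))
  have hVc : Continuous H.V := H.V_C2.continuous
  rw [Metric.tendstoUniformlyOn_iff]
  intro e he
  obtain ⟨R, hR, hball⟩ := htight (e / (8 * M')) (by positivity)
  obtain ⟨LK, hLK⟩ := hK.bddAbove_image hVc.continuousOn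
  obtain ⟨LR, hLR⟩ := (isCompact_closedBall (0 : Ed d) R).bddAbove_image hVc.continuousOn
  have hlim : Tendsto (fun t : ℝ => B * Real.exp (-lam * (t - s)) * (1 + ε * (LK + LR))) atTop
      (𝓝 0) := by
    have h1 : Tendsto (fun t : ℝ => -lam * (t - s)) atTop atBot :=
      (tendsto_atTop_add_const_right atTop (-s) tendsto_id).const_mul_atTop_of_neg
        (neg_lt_zero.2 hlam)
    have h2 := ((Real.tendsto_exp_atBot.comp h1).const_mul B).mul_const (1 + ε * (LK + LR))
    simpa using h2
  filter_upwards [hlim.eventually (gt_mem_nhds (show (0:ℝ) < e / 4 by positivity)),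
    eventually_gt_atTop s] with t ht hts x hx
  have ht0 : (0:ℝ) ≤ t := hs.trans hts.le
  have := hsys.1 t ht0
  have hut : Continuous (H.G t s f) := (hu.smooth_space t hts).continuous
  have hGi : Integrable (fun y => H.G t s f x - H.G t s f y) (μ t) := by
    refine Integrable.of_bound (by fun_prop) (2 * M') (Eventually.of_forall fun y => ?_)
    have h5 := abs_le.1 (hMu t hts.le x)
    have h6 := abs_le.1 (hMu t hts.le y)
    rw [Real.norm_eq_abs, abs_le]
    constructor <;> linarith [h5.1, h5.2, h6.1, h6.2]
  have hGi2 : Integrable (H.G t s f) (μ t) :=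
    Integrable.of_bound (by fun_prop) M' (Eventually.of_forall fun y => hMu t hts.le y)
  have heq : ∫ y, (H.G t s f x - H.G t s f y) ∂μ t = H.G t s f x - ∫ y, f y ∂μ s := by
    rw [integral_sub (integrable_const _) hGi2, hsys.2 f hf s hs t hts.le]
    simp
  have hmeas : MeasurableSet (ball (0 : Ed d) R)ᶜ := measurableSet_ball.compl
  have hsmall : (μ t).real (ball (0 : Ed d) R)ᶜ ≤ e / (8 * M') := by
    rw [probReal_compl_eq_one_sub measurableSet_ball]
    have h1 := (ENNReal.ofReal_le_iff_le_toReal (measure_ne_top _ _)).1 (hball t ht0)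
    have h2 : 1 - e / (8 * M') ≤ (μ t).real (ball (0 : Ed d) R) := h1
    linarith
  have hbound : ∀ y, |H.G t s f x - H.G t s f y| ≤
      e / 4 + (ball (0 : Ed d) R)ᶜ.indicator (fun _ => 2 * M') y := by
    intro y
    by_cases hy : y ∈ ball (0 : Ed d) R
    · rw [indicator_of_notMem (by simpa using hy), add_zero]
      have hx1 : H.V x ≤ LK := hLK (mem_image_of_mem _ hx)
      have hy1 : H.V y ≤ LR := hLR (mem_image_of_mem _ (ball_subset_closedBall hy))
      have hE : B * Real.exp (-lam * (t - s)) * (1 + ε * (H.V x + H.V y)) ≤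
          B * Real.exp (-lam * (t - s)) * (1 + ε * (LK + LR)) := by gcongr
      have h1 := hdec t hts.le x y
      have h2 := hdec t hts.le y x
      rw [add_comm (H.V y)] at h2
      rw [abs_le]
      constructor <;> linarith
    · rw [indicator_of_mem (by simpa using hy)]
      have h5 := abs_le.1 (hMu t hts.le x)
      have h6 := abs_le.1 (hMu t hts.le y)
      rw [abs_le]
      constructor <;> linarith [h5.1, h5.2, h6.1, h6.2]
  have hI : Integrable ((ball (0 : Ed d) R)ᶜ.indicator (fun _ => 2 * M')) (μ t) :=
    (integrable_const _).indicator hmeas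
  have h1 : |∫ y, (H.G t s f x - H.G t s f y) ∂μ t| ≤
      ∫ y, (e / 4 + (ball (0 : Ed d) R)ᶜ.indicator (fun _ => 2 * M') y) ∂μ t :=
    abs_integral_le_integral_abs.trans
      (integral_mono hGi.abs ((integrable_const _).add hI) hbound)
  rw [integral_add (integrable_const _) hI, integral_indicator hmeas, heq] at h1
  simp only [integral_const, smul_eq_mul, probReal_univ, one_mul,
    measureReal_restrict_apply_univ] at h1
  have h2 : (μ t).real (ball (0 : Ed d) R)ᶜ * (2 * M') ≤ e / (8 * M') * (2 * M') :=
    mul_le_mul_of_nonneg_right hsmall (by positivity)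
  have h3 : e / (8 * M') * (2 * M') = e / 4 := by field_simp; norm_num
  rw [dist_comm, Real.dist_eq]
  linarith
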